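/- Let 𝕀 = (I, ≤, 𝓘) be a set of indices, let 𝓑 and 𝒵 be asymptotic gauges on 𝕀, and let Ω ⊆ ℝⁿ be an open set. Then every 𝒵-negligible net of smooth functions is 𝓑-moderate: 𝒩(𝒵,Ω) ⊆ ℰ_M(𝓑,Ω). -/

import Mathlib

open MeasureTheory

/-- Strict order relation used in the paper: `x < y` iff `x ≤ y` and `x ≠ y`. -/
def sLT {I : Type*} [Preorder I] (x y : I) : Prop := x ≤ y ∧ x ≠ y

/-- A set of indices `𝕀 = (I, ≤, 𝓘)` in the sense of Giordano–Luperi Baglini. -/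
structure SetOfIndices (I : Type*) [Preorder I] where
  sets : Set (Set I)
  empty_not_mem : (∅ : Set I) ∉ sets
  univ_mem : (Set.univ : Set I) ∈ sets
  inter_sub : ∀ A ∈ sets, ∀ B ∈ sets, ∃ C ∈ sets, C ⊆ A ∩ B
  downward : ∀ A ∈ sets, ∀ a ∈ A, ∀ e, e ≤ a →
    ((∃ ε, ε ∈ A ∧ ε ≤ e) ∧
      (∀ b ∈ A, b ≤ e → ∀ c ∈ A, c ≤ e →
        ∃ d, d ∈ A ∧ d ≤ e ∧ sLT d b ∧ sLT d c))

section Defs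

variable {I : Type*} [Preorder I]

/-- `x = O_{a,A}(y)`. -/
def BigOaA (A : Set I) (a : I) (x y : I → ℝ) : Prop :=
  ∃ H : ℝ, 0 < H ∧ ∃ ε₀, ε₀ ∈ A ∧ ε₀ ≤ a ∧ ∀ ε ∈ A, ε ≤ ε₀ → |x ε| ≤ H * |y ε|

/-- `x = O_𝒥(y)` for a family `𝒥` of subsets of `I`. -/
def BigOJ (J : Set (Set I)) (x y : I → ℝ) : Prop :=
  ∃ A ∈ J, ∀ a ∈ A, BigOaA A a x y

/-- `x = O(y)` (i.e. `O_𝓘`). -/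
def BigO (S : SetOfIndices I) (x y : I → ℝ) : Prop := BigOJ S.sets x y

/-- `i >_𝕀 j`. -/
def gtI (S : SetOfIndices I) (i j : I → ℝ) : Prop :=
  ∃ A ∈ S.sets, ∀ a ∈ A, ∃ e, e ∈ A ∧ e ≤ a ∧ ∀ ε ∈ A, ε ≤ e → j ε < i ε

/-- `P(ε)` holds for `ε` sufficiently small in `𝕀`. -/
def EventuallyI (S : SetOfIndices I) (P : I → Prop) : Prop :=
  ∃ A ∈ S.sets, ∀ a ∈ A, ∃ e, e ∈ A ∧ e ≤ a ∧ ∀ ε ∈ A, ε ≤ e → P ε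

/-- `lim_𝕀 f = l` for a finite limit `l ∈ ℝ`. -/
def limEq (S : SetOfIndices I) (f : I → ℝ) (l : ℝ) : Prop :=
  ∃ A ∈ S.sets, ∀ a ∈ A, ∀ r : ℝ, 0 < r →
    ∃ a₀, a₀ ≤ a ∧ ∀ ε ∈ A, ε ≤ a₀ → |l - f ε| < r

/-- `lim_𝕀 f = ∞` (unsigned infinity). -/
def limInfinite (S : SetOfIndices I) (f : I → ℝ) : Prop :=
  ∃ A ∈ S.sets, ∀ a ∈ A, ∀ R : ℝ, 0 < R →
    ∃ a₀, a₀ ≤ a ∧ ∀ ε ∈ A, ε ≤ a₀ → R < |f ε|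

/-- `lim_𝕀 f = +∞`. -/
def limPInf (S : SetOfIndices I) (f : I → ℝ) : Prop :=
  ∃ A ∈ S.sets, ∀ a ∈ A, ∀ R : ℝ, 0 < R →
    ∃ a₀, a₀ ≤ a ∧ ∀ ε ∈ A, ε ≤ a₀ → R < f ε

/-- `𝓑` is an asymptotic gauge on the set of indices `S`. -/
structure IsAG (S : SetOfIndices I) (B : Set (I → ℝ)) : Prop where
  infinite : ∃ i ∈ B, limInfinite S i
  mul : ∀ i ∈ B, ∀ j ∈ B, ∃ p ∈ B, BigO S (fun ε => i ε * j ε) p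
  smul : ∀ i ∈ B, ∀ r : ℝ, ∃ σ ∈ B, BigO S (fun ε => r * i ε) σ
  absAdd : ∀ i ∈ B, ∀ j ∈ B, ∃ s ∈ B, gtI S s (fun _ => 0) ∧
    BigO S (fun ε => |i ε| + |j ε|) s

/-- `𝓑_{>0}`, the positive part of `𝓑`. -/
def agPos (S : SetOfIndices I) (B : Set (I → ℝ)) : Set (I → ℝ) :=
  {i ∈ B | gtI S i (fun _ => 0)}

/-- `ℝ_M(𝓑)`, the moderate nets generated by `𝓑`. -/
def RM (S : SetOfIndices I) (B : Set (I → ℝ)) : Set (I → ℝ) :=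
  {x | ∃ b ∈ B, BigO S x b}

/-- `sup_{x ∈ K} |f x|`. -/
noncomputable def supAbsOn {X : Type*} (K : Set X) (f : X → ℝ) : ℝ :=
  sSup ((fun x => |f x|) '' K)

/-- Partial derivative of `f : ℝⁿ → ℝ` in the `i`-th coordinate direction. -/
noncomputable def pDeriv {n : ℕ} (i : Fin n) (f : (Fin n → ℝ) → ℝ) :
    (Fin n → ℝ) → ℝ :=
  fun x => fderiv ℝ f x (Pi.single i 1)

/-- Iterated partial derivative `∂^α f` along a list of coordinate directions
(the list encodes the multi-index `α ∈ ℕⁿ`). -/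
noncomputable def multiDeriv {n : ℕ} : List (Fin n) → ((Fin n → ℝ) → ℝ) → ((Fin n → ℝ) → ℝ)
  | [], f => f
  | i :: l, f => multiDeriv l (pDeriv i f)

/-- `ℰ_M(𝓑,Ω)`: the `𝓑`-moderate nets of smooth functions on `Ω ⊆ ℝⁿ`. -/
def EMod (S : SetOfIndices I) (B : Set (I → ℝ)) {n : ℕ} (Ω : Set (Fin n → ℝ))
    (u : I → (Fin n → ℝ) → ℝ) : Prop :=
  ∀ K : Set (Fin n → ℝ), K ⊆ Ω → IsCompact K → ∀ l : List (Fin n),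
    ∃ b ∈ B, BigO S (fun ε => supAbsOn K (multiDeriv l (u ε))) b

/-- `𝒩(𝒵,Ω)`: the `𝒵`-negligible nets of smooth functions on `Ω ⊆ ℝⁿ`. -/
def NNeg (S : SetOfIndices I) (Z : Set (I → ℝ)) {n : ℕ} (Ω : Set (Fin n → ℝ))
    (u : I → (Fin n → ℝ) → ℝ) : Prop :=
  ∀ K : Set (Fin n → ℝ), K ⊆ Ω → IsCompact K → ∀ l : List (Fin n),
    ∀ z ∈ agPos S Z,
      BigO S (fun ε => supAbsOn K (multiDeriv l (u ε))) (fun ε => (z ε)⁻¹)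

/-- One–dimensional version of `ℰ_M(𝓑,ℝ)`, using iterated derivatives. -/
def EM1 (S : SetOfIndices I) (B : Set (I → ℝ)) (u : I → ℝ → ℝ) : Prop :=
  ∀ K : Set ℝ, IsCompact K → ∀ k : ℕ,
    ∃ b ∈ B, BigO S (fun ε => supAbsOn K (iteratedDeriv k (u ε))) b

/-- One–dimensional version of `𝒩(𝒵,ℝ)`, using iterated derivatives. -/
def NEG1 (S : SetOfIndices I) (Z : Set (I → ℝ)) (u : I → ℝ → ℝ) : Prop :=
  ∀ K : Set ℝ, IsCompact K → ∀ k : ℕ, ∀ z ∈ agPos S Z,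
    BigO S (fun ε => supAbsOn K (iteratedDeriv k (u ε))) (fun ε => (z ε)⁻¹)

/-- `AG(b) = {b^m ∣ m ∈ ℕ}`, the principal asymptotic gauge generated by `b`. -/
def AGpow (b : I → ℝ) : Set (I → ℝ) := {g | ∃ m : ℕ, g = fun ε => (b ε) ^ m}

/-- `e^𝓑 = {e^{H·b} ∣ H > 0, b ∈ 𝓑}`, the exponential of the asymptotic gauge `𝓑`. -/
def expAG (B : Set (I → ℝ)) : Set (I → ℝ) :=
  {g | ∃ H : ℝ, 0 < H ∧ ∃ b ∈ B, g = fun ε => Real.exp (H * b ε)}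

end Defs

/-- `O` is transitive. -/
theorem BigO.trans {I : Type*} [Preorder I] {S : SetOfIndices I} {x y z : I → ℝ}
    (hxy : BigO S x y) (hyz : BigO S y z) : BigO S x z := by
  obtain ⟨A, hA, hxy⟩ := hxy
  obtain ⟨A', hA', hyz⟩ := hyz
  obtain ⟨C, hC, hCA⟩ := S.inter_sub A hA A' hA'
  refine ⟨C, hC, fun a ha => ?_⟩
  obtain ⟨H, hH, e, -, hea, hx⟩ := hxy a (hCA ha).1
  obtain ⟨e₁, he₁C, he₁⟩ := (S.downward C hC a ha e hea).1
  obtain ⟨H', hH', e', -, he'e₁, hy⟩ := hyz e₁ (hCA he₁C).2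
  obtain ⟨e₂, he₂C, he₂⟩ := (S.downward C hC e₁ he₁C e' he'e₁).1
  refine ⟨H * H', mul_pos hH hH', e₂, he₂C,
    he₂.trans (he'e₁.trans (he₁.trans hea)), fun ε hε hεe => ?_⟩
  calc |x ε| ≤ H * |y ε| :=
        hx ε (hCA hε).1 (hεe.trans (he₂.trans (he'e₁.trans he₁)))
    _ ≤ H * (H' * |z ε|) :=
        mul_le_mul_of_nonneg_left (hy ε (hCA hε).2 (hεe.trans he₂)) hH.le
    _ = H * H' * |z ε| := (mul_assoc _ _ _).symm

/-- A pointwise bound in absolute value gives an `O` bound. -/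
theorem BigO.of_abs_le {I : Type*} [Preorder I] {S : SetOfIndices I} {x y : I → ℝ}
    (h : ∀ ε, |x ε| ≤ |y ε|) : BigO S x y :=
  ⟨Set.univ, S.univ_mem, fun a _ =>
    ⟨1, one_pos, a, Set.mem_univ a, le_rfl, fun ε _ _ => by simpa using h ε⟩⟩

/-- A net that tends to infinity dominates the constant net `1`. -/
theorem limInfinite.one_bigO {I : Type*} [Preorder I] {S : SetOfIndices I} {f : I → ℝ}
    (hf : limInfinite S f) : BigO S (fun _ => 1) f := by
  obtain ⟨A, hA, hf⟩ := hf
  refine ⟨A, hA, fun a ha => ?_⟩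
  obtain ⟨a₀, ha₀, hlt⟩ := hf a ha 1 one_pos
  obtain ⟨e, heA, he⟩ := (S.downward A hA a ha a₀ ha₀).1
  refine ⟨1, one_pos, e, heA, he.trans ha₀, fun ε hε hεe => ?_⟩
  simpa using (hlt ε hε (hεe.trans he)).le

/-- The reciprocal of a net that dominates `1` is bounded. -/
theorem BigO.inv_bigO_one {I : Type*} [Preorder I] {S : SetOfIndices I} {s : I → ℝ}
    (h : BigO S (fun _ => 1) s) : BigO S (fun ε => (s ε)⁻¹) (fun _ => 1) := by
  obtain ⟨A, hA, h⟩ := h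
  refine ⟨A, hA, fun a ha => ?_⟩
  obtain ⟨H, hH, e, heA, he, hs⟩ := h a ha
  refine ⟨H, hH, e, heA, he, fun ε hε hεe => ?_⟩
  have h1 : 1 ≤ H * |s ε| := by simpa using hs ε hε hεe
  have hpos : 0 < |s ε| := pos_of_mul_pos_right (one_pos.trans_le h1) hH.le
  rw [abs_inv, abs_one, mul_one]
  exact inv_le_of_inv_le₀ hH ((inv_le_iff_one_le_mul₀' hH).2 h1)

/-- negligible nets are moderate (Lem. `negligibleAreModerate`). -/
theorem negligible_subset_moderate {I : Type*} [Preorder I] (S : SetOfIndices I)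
    {n : ℕ} (B Z : Set (I → ℝ)) (hB : IsAG S B) (hZ : IsAG S Z)
    (Ω : Set (Fin n → ℝ)) (hΩ : IsOpen Ω)
    (u : I → (Fin n → ℝ) → ℝ) (hu : ∀ ε, ContDiffOn ℝ (⊤ : ℕ∞) (u ε) Ω)
    (hneg : NNeg S Z Ω u) :
    EMod S B Ω u := by
  intro K hKΩ hK l
  obtain ⟨b, hbB, hb⟩ := hB.infinite
  obtain ⟨i, hiZ, hi⟩ := hZ.infinite
  obtain ⟨s, hsZ, hs_pos, his⟩ := hZ.absAdd i hiZ i hiZ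
  have hle : BigO S i (fun ε => |i ε| + |i ε|) := BigO.of_abs_le fun ε =>
    (le_add_of_nonneg_left (abs_nonneg (i ε))).trans (le_abs_self _)
  have hs : BigO S (fun _ => 1) s := hi.one_bigO.trans (hle.trans his)
  exact ⟨b, hbB, (hneg K hKΩ hK l s ⟨hsZ, hs_pos⟩).trans (hs.inv_bigO_one.trans hb.one_bigO)⟩
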